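/- Consider the H-model with parameter p and suppose θ = θ_NE(1−p) > 0. Then for any n, d > 0 there exist 0 < N < M₀ < M with M₀ − N > d such that P(B⁺_{M,n}(x)) > θ/2 for every x ∈ [N, M₀]. -/

import Mathlib

open MeasureTheory ENNReal

namespace RandomOrientation

/-- One step of the base-`(p, 1-p)` expansion map on `[0,1)`. -/
noncomputable def expand (p x : ℝ) : ℝ := if x < p then x / p else (x - p) / (1 - p)

/-- The `n`-th digit of the Bernoulli(`p`) expansion of `x`: for `x` uniformly
distributed on `[0,1)` the digits are i.i.d. `{true, false}`-valued with
`P(true) = p`. -/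
noncomputable def bernDigit (p : ℝ) (n : ℕ) (x : ℝ) : Bool :=
  decide ((expand p)^[n] x < p)

/-- The product over the countable index set `I` of Bernoulli(`p`) measures on
`Bool` (`P(true) = p`), realized as the joint distribution of the digits of the
Bernoulli(`p`) expansion of a uniform random point of `[0,1)`. -/
noncomputable def bernoulliProduct (I : Type*) [Encodable I] (p : ℝ) :
    Measure (I → Bool) :=
  Measure.map (fun x i => bernDigit p (Encodable.encode i) x)
    (volume.restrict (Set.Ico (0 : ℝ) 1))

/-- Edges of `ℤ²`: `(v, false)` is the horizontal edge from `v` to `v + (1,0)`,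
`(v, true)` the vertical edge from `v` to `v + (0,1)`. -/
abbrev Edge : Type := (ℤ × ℤ) × Bool

/-- An orientation configuration of the edges of `ℤ²`. -/
abbrev Config : Type := Edge → Bool

def eSrc (e : Edge) : ℤ × ℤ := e.1

def eDst (e : Edge) : ℤ × ℤ := if e.2 then (e.1.1, e.1.2 + 1) else (e.1.1 + 1, e.1.2)

/-- The law of the random orientation with parameter `p`: each edge independently
carries the bit `true` with probability `p`. -/
noncomputable def mu (p : ℝ) : Measure Config := bernoulliProduct Edge p

/-- The directed-edge relation of Grimmett's random-orientation model:
`ω e = true` means the edge `e` is oriented in the positive coordinate direction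
(rightwards resp. upwards), `ω e = false` in the negative one. -/
def gStep (ω : Config) (u v : ℤ × ℤ) : Prop :=
  ∃ e : Edge, (eSrc e = u ∧ eDst e = v ∧ ω e = true) ∨ (eSrc e = v ∧ eDst e = u ∧ ω e = false)

/-- Squared euclidean norm on `ℤ²`. -/
def normSq (v : ℤ × ℤ) : ℤ := v.1 ^ 2 + v.2 ^ 2

/-- The directed-edge relation of the H-model: `ω e = true` means the edge `e` is
oriented away from the origin, i.e. towards its endpoint of larger euclidean norm
(adjacent vertices of `ℤ²` never have equal norms). -/
def hStep (ω : Config) (u v : ℤ × ℤ) : Prop :=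
  ∃ e : Edge, ((eSrc e = u ∧ eDst e = v) ∨ (eSrc e = v ∧ eDst e = u)) ∧
    ω e = decide (normSq u < normSq v)

/-- There is an infinite directed self-avoiding path starting at the origin,
all of whose vertices lie in `S`, for the directed-step relation `R`. -/
def percolates (R : ℤ × ℤ → ℤ × ℤ → Prop) (S : Set (ℤ × ℤ)) : Prop :=
  ∃ γ : ℕ → ℤ × ℤ, γ 0 = (0, 0) ∧ Function.Injective γ ∧
    (∀ n, R (γ n) (γ (n + 1))) ∧ ∀ n, γ n ∈ S

/-- The (closed) North-East quadrant of `ℤ²`. -/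
def NEquad : Set (ℤ × ℤ) := {v | 0 ≤ v.1 ∧ 0 ≤ v.2}

/-- `θ_H(p)`: percolation probability of the H-model with parameter `p`. -/
noncomputable def thetaH (p : ℝ) : ℝ≥0∞ := mu p {ω | percolates (hStep ω) Set.univ}

/-- `θ_NE(p)`: probability of an infinite directed self-avoiding path from the
origin staying in the North-East quadrant, in the random-orientation model. -/
noncomputable def thetaNE (p : ℝ) : ℝ≥0∞ := mu p {ω | percolates (gStep ω) NEquad}

/-- `θ_G(p)`: percolation probability of Grimmett's random-orientation model. -/
noncomputable def thetaG (p : ℝ) : ℝ≥0∞ := mu p {ω | percolates (gStep ω) Set.univ}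

/-- The primal edge `e` is oriented in the positive coordinate direction, for the
H-model configuration `ω` (`ω e = true` means oriented away from the origin). -/
def hPos (ω : Config) (e : Edge) : Prop := ω e = decide (normSq (eSrc e) < normSq (eDst e))

/-- Directed step relation of the dual lattice `ℤ²ᵘ_d`.  The coded dual vertex
`(a, b) : ℤ × ℤ` stands for the point `(a + 1/2, b + 1/2)`.  A dual edge is
oriented in the direction of the *absent* orientation of the primal edge it
crosses, rotated by `π/2`; the dual edge between `(a,b)` and `(a+1,b)` crosses
the primal vertical edge `((a+1, b), true)`, and the dual edge between `(a,b)`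
and `(a,b+1)` crosses the primal horizontal edge `((a, b+1), false)`. -/
def dualStep (ω : Config) (d d' : ℤ × ℤ) : Prop :=
  (d' = (d.1 + 1, d.2) ∧ hPos ω ((d.1 + 1, d.2), true)) ∨
  (d = (d'.1 + 1, d'.2) ∧ ¬hPos ω ((d'.1 + 1, d'.2), true)) ∨
  (d' = (d.1, d.2 + 1) ∧ ¬hPos ω ((d.1, d.2 + 1), false)) ∨
  (d = (d'.1, d'.2 + 1) ∧ hPos ω ((d'.1, d'.2 + 1), false))

/-- The coded dual vertex `d` (i.e. the point `d + (1/2, 1/2)`) lies in the box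
`Λ_m = [-m, m]²`. -/
def inBox (m : ℕ) (d : ℤ × ℤ) : Prop := -(m : ℤ) ≤ d.1 ∧ d.1 < m ∧ -(m : ℤ) ≤ d.2 ∧ d.2 < m

/-- The coded dual vertex lies in the (open) NE quadrant `x > 0, y > 0`. -/
def dualNE (d : ℤ × ℤ) : Prop := 0 ≤ d.1 ∧ 0 ≤ d.2

/-- The coded dual vertex lies in the NW quadrant `x < 0, y > 0`. -/
def dualNW (d : ℤ × ℤ) : Prop := d.1 < 0 ∧ 0 ≤ d.2

/-- The coded dual vertex lies in the SW quadrant `x < 0, y < 0`. -/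
def dualSW (d : ℤ × ℤ) : Prop := d.1 < 0 ∧ d.2 < 0

/-- The coded dual vertex lies in the SE quadrant `x > 0, y < 0`. -/
def dualSE (d : ℤ × ℤ) : Prop := 0 ≤ d.1 ∧ d.2 < 0

/-- `B⁺_{m,n}(x)` for `x = k + 1/2`: in the dual lattice `ℤ²ᵘ_d` of the H-model
there is a directed path from `(x, 1/2)` (coded `(k, 0)`) to `(1/2, y)` for some
`y > 0` (coded `(0, b)`, `b ≥ 0`), lying entirely inside the dual NE quadrant and
inside `Λ_m \ Λ_n`. -/
def BplusIn (m n k : ℕ) (ω : Config) : Prop :=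
  ∃ (γ : ℕ → ℤ × ℤ) (L : ℕ), γ 0 = ((k : ℤ), 0) ∧ (γ L).1 = 0 ∧
    (∀ i < L, dualStep ω (γ i) (γ (i + 1))) ∧
    ∀ i ≤ L, dualNE (γ i) ∧ inBox m (γ i) ∧ ¬inBox n (γ i)

/-- The Bernoulli law on `Bool` giving mass `p` to `true` and `1 - p` to `false`. -/
noncomputable def bern (p : ℝ) : Measure Bool :=
  ENNReal.ofReal p • Measure.dirac true + ENNReal.ofReal (1 - p) • Measure.dirac false

lemma bern_apply (p : ℝ) (t : Set Bool) :
    bern p t = ENNReal.ofReal p * t.indicator 1 true +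
      ENNReal.ofReal (1 - p) * t.indicator 1 false := by
  simp [bern]

lemma isProbabilityMeasure_bern {p : ℝ} (hp0 : 0 ≤ p) (hp1 : p ≤ 1) :
    IsProbabilityMeasure (bern p) := by
  refine ⟨?_⟩
  rw [bern_apply]
  simp [← ENNReal.ofReal_add hp0 (sub_nonneg.2 hp1)]

lemma map_not_bern (p : ℝ) : (bern p).map (fun b => !b) = bern (1 - p) := by
  ext t ht
  rw [Measure.map_apply (measurable_of_finite _) ht, bern_apply, bern_apply]
  have h (b : Bool) : ((fun b => !b) ⁻¹' t).indicator (1 : Bool → ℝ≥0∞) b =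
      t.indicator 1 (!b) := rfl
  rw [h, h, show 1 - (1 - p) = p by ring, add_comm]
  rfl

lemma measurable_expand (p : ℝ) : Measurable (expand p) := by
  unfold expand
  exact Measurable.ite measurableSet_Iio (by fun_prop) (by fun_prop)

lemma measurable_bernDigit (p : ℝ) (n : ℕ) : Measurable (bernDigit p n) := by
  unfold bernDigit
  refine measurable_to_bool ?_
  convert measurableSet_lt ((measurable_expand p).iterate n) (measurable_const (a := p)) using 1
  ext x
  simp

lemma bernDigit_succ (p : ℝ) (n : ℕ) (x : ℝ) :
    bernDigit p (n + 1) x = bernDigit p n (expand p x) := by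
  exact decide_eq_decide.2 (by rw [Function.iterate_succ_apply])

/-- The uniform law on `[0, 1)`. -/
noncomputable abbrev unif : Measure ℝ := volume.restrict (Set.Ico (0 : ℝ) 1)

lemma unif_lt_inter_expand {p : ℝ} (hp0 : 0 ≤ p) (hp1 : p ≤ 1) {A : Set ℝ}
    (hA : MeasurableSet A) :
    unif ({x | x < p} ∩ expand p ⁻¹' A) = ENNReal.ofReal p * unif A := by
  have hlt : MeasurableSet {x : ℝ | x < p} := measurableSet_Iio
  rw [Measure.restrict_apply (hlt.inter (measurable_expand p hA)), Measure.restrict_apply hA]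
  rcases hp0.eq_or_lt with rfl | hp
  · have : ({x | x < 0} ∩ expand 0 ⁻¹' A) ∩ Set.Ico (0 : ℝ) 1 = ∅ := by
      ext x
      simp only [Set.mem_inter_iff, Set.mem_ofPred_eq, Set.mem_Ico, Set.mem_empty_iff_false,
        iff_false]
      rintro ⟨⟨h, -⟩, h', -⟩
      linarith
    simp [this]
  · have : ({x | x < p} ∩ expand p ⁻¹' A) ∩ Set.Ico (0 : ℝ) 1 =
        (fun x => p⁻¹ * x) ⁻¹' (A ∩ Set.Ico 0 1) := by
      ext x
      simp only [Set.mem_inter_iff, Set.mem_ofPred_eq, Set.mem_Ico, Set.mem_preimage]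
      rw [show p⁻¹ * x = x / p by ring, div_lt_one hp, le_div_iff₀ hp, zero_mul]
      constructor
      · rintro ⟨⟨h, h'⟩, h0, -⟩
        rw [expand, if_pos h] at h'
        exact ⟨h', h0, h⟩
      · rintro ⟨h', h0, h⟩
        rw [expand, if_pos h]
        exact ⟨⟨h, h'⟩, h0, by linarith⟩
    rw [this, Real.volume_preimage_mul_left (inv_ne_zero hp.ne'), inv_inv, abs_of_pos hp]

lemma unif_not_lt_inter_expand {p : ℝ} (hp0 : 0 ≤ p) (hp1 : p ≤ 1) {A : Set ℝ}
    (hA : MeasurableSet A) :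
    unif ({x | ¬x < p} ∩ expand p ⁻¹' A) = ENNReal.ofReal (1 - p) * unif A := by
  have hge : MeasurableSet {x : ℝ | ¬x < p} := measurableSet_Iio.compl
  rw [Measure.restrict_apply (hge.inter (measurable_expand p hA)), Measure.restrict_apply hA]
  rcases hp1.eq_or_lt with rfl | hp
  · have : ({x | ¬x < 1} ∩ expand 1 ⁻¹' A) ∩ Set.Ico (0 : ℝ) 1 = ∅ := by
      ext x
      simp only [Set.mem_inter_iff, Set.mem_ofPred_eq, Set.mem_Ico, Set.mem_empty_iff_false,
        iff_false]
      rintro ⟨⟨h, -⟩, -, h'⟩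
      exact h h'
    rw [this]
    simp
  · have hq : 0 < 1 - p := sub_pos.2 hp
    have : ({x | ¬x < p} ∩ expand p ⁻¹' A) ∩ Set.Ico (0 : ℝ) 1 =
        (fun x => -p + x) ⁻¹' ((fun x => (1 - p)⁻¹ * x) ⁻¹' (A ∩ Set.Ico 0 1)) := by
      ext x
      simp only [Set.mem_inter_iff, Set.mem_ofPred_eq, Set.mem_Ico, Set.mem_preimage]
      rw [show (1 - p)⁻¹ * (-p + x) = (x - p) / (1 - p) by ring, div_lt_one hq,
        le_div_iff₀ hq, zero_mul]
      constructor
      · rintro ⟨⟨h, h'⟩, h0, h1⟩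
        rw [expand, if_neg h] at h'
        exact ⟨h', by linarith, by linarith⟩
      · rintro ⟨h', h0, h⟩
        have hx : ¬x < p := by linarith
        rw [expand, if_neg hx]
        exact ⟨⟨hx, h'⟩, by linarith, by linarith⟩
    rw [this, measure_preimage_add, Real.volume_preimage_mul_left (inv_ne_zero hq.ne'), inv_inv,
      abs_of_pos hq]

lemma unif_digit_zero_inter_expand {p : ℝ} (hp0 : 0 ≤ p) (hp1 : p ≤ 1) (t : Set Bool)
    {A : Set ℝ} (hA : MeasurableSet A) :
    unif (bernDigit p 0 ⁻¹' t ∩ expand p ⁻¹' A) = bern p t * unif A := by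
  have h1 : MeasurableSet {x : ℝ | x < p} := measurableSet_Iio
  rw [← measure_inter_add_sdiff _ h1, bern_apply, add_mul]
  congr 1
  · by_cases ht : true ∈ t
    · simp only [Set.indicator_of_mem ht, Pi.one_apply, mul_one]
      rw [← unif_lt_inter_expand hp0 hp1 hA]
      congr 1
      ext x
      by_cases hx : x < p <;> simp [bernDigit, hx, ht]
    · simp only [Set.indicator_of_notMem ht, mul_zero, zero_mul]
      convert measure_empty (μ := unif) using 2
      ext x
      by_cases hx : x < p <;> simp [bernDigit, hx, ht]
  · by_cases ht : false ∈ t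
    · simp only [Set.indicator_of_mem ht, Pi.one_apply, mul_one]
      rw [← unif_not_lt_inter_expand hp0 hp1 hA]
      congr 1
      ext x
      by_cases hx : x < p
      · simp [hx]
      · simp [bernDigit, hx, ht, not_lt.1 hx]
    · simp only [Set.indicator_of_notMem ht, mul_zero, zero_mul]
      convert measure_empty (μ := unif) using 2
      ext x
      by_cases hx : x < p <;> simp [bernDigit, hx, ht]

lemma unif_digits_mem {p : ℝ} (hp0 : 0 ≤ p) (hp1 : p ≤ 1) (n : ℕ) (t : ℕ → Set Bool) :
    unif {x | ∀ i < n, bernDigit p i x ∈ t i} = ∏ i ∈ Finset.range n, bern p (t i) := by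
  induction n generalizing t with
  | zero => simp
  | succ n ih =>
    have hA : MeasurableSet {x | ∀ i < n, bernDigit p i x ∈ t (i + 1)} := by
      simp only [Set.ofPred_forall]
      exact .iInter fun i => .iInter fun _ =>
        measurable_bernDigit p i (MeasurableSet.of_discrete (s := t (i + 1)))
    rw [Finset.prod_range_succ', mul_comm, ← ih, ← unif_digit_zero_inter_expand hp0 hp1 _ hA]
    congr 1
    ext x
    simp only [Set.mem_ofPred_eq, Set.mem_inter_iff, Set.mem_preimage, ← bernDigit_succ]
    constructor
    · exact fun h => ⟨h 0 (by omega), fun i hi => h (i + 1) (by omega)⟩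
    · rintro ⟨h0, h⟩ (_ | i) hi
      · exact h0
      · exact h i (by omega)

lemma map_digits {p : ℝ} (hp0 : 0 ≤ p) (hp1 : p ≤ 1) :
    unif.map (fun x (i : ℕ) => bernDigit p i x) = Measure.infinitePi fun _ => bern p := by
  have := isProbabilityMeasure_bern hp0 hp1
  classical
  refine Measure.eq_infinitePi _ fun s t ht => ?_
  rw [Measure.map_apply (measurable_pi_iff.2 (measurable_bernDigit p))
    (.pi s.countable_toSet fun i _ => ht i)]
  have h := unif_digits_mem hp0 hp1 (s.sup id + 1) fun i => if i ∈ s then t i else Set.univ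
  have hs : s ⊆ Finset.range (s.sup id + 1) := fun i hi =>
    Finset.mem_range.2 (Nat.lt_succ_of_le (Finset.le_sup (f := id) hi))
  rw [← Finset.prod_subset hs (fun i _ hi => by rw [if_neg hi, measure_univ])] at h
  rw [Finset.prod_congr rfl fun i hi => by rw [if_pos hi]] at h
  rw [← h]
  congr 1
  ext x
  simp only [Set.mem_preimage, Set.mem_pi, Finset.mem_coe, Set.mem_ofPred_eq]
  constructor
  · intro hx i _
    split_ifs with hi
    · exact hx i hi
    · trivial
  · intro hx i hi
    simpa [hi] using hx i (Finset.mem_range.1 (hs hi))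

lemma mu_eq_infinitePi {p : ℝ} (hp0 : 0 ≤ p) (hp1 : p ≤ 1) :
    mu p = Measure.infinitePi fun _ => bern p := by
  have := isProbabilityMeasure_bern hp0 hp1
  rw [mu, bernoulliProduct,
    ← Measure.map_infinitePi_infinitePi_of_inj (P := fun _ : ℕ => bern p)
      (Encodable.encode_injective (α := Edge)), ← map_digits hp0 hp1,
    Measure.map_map (by fun_prop) (measurable_pi_iff.2 (measurable_bernDigit p))]
  rfl

lemma isProbabilityMeasure_mu {p : ℝ} (hp0 : 0 ≤ p) (hp1 : p ≤ 1) :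
    IsProbabilityMeasure (mu p) := by
  have := isProbabilityMeasure_bern hp0 hp1
  rw [mu_eq_infinitePi hp0 hp1]
  infer_instance

/-- Reindexing the edges injectively and reversing every bit turns parameter `p` into `1 - p`. -/
lemma map_not_reindex_mu {p : ℝ} (hp0 : 0 ≤ p) (hp1 : p ≤ 1) {f : Edge → Edge}
    (hf : Function.Injective f) :
    (mu p).map (fun ω e => !ω (f e)) = mu (1 - p) := by
  have := isProbabilityMeasure_bern hp0 hp1
  have hnot : Measurable fun (ω : Config) e => !ω e :=
    measurable_pi_iff.2 fun e => (measurable_of_finite not).comp (measurable_pi_apply e)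
  have hre := Measure.map_infinitePi_infinitePi_of_inj (P := fun _ : Edge => bern p) hf
  rw [mu_eq_infinitePi hp0 hp1, mu_eq_infinitePi (sub_nonneg.2 hp1) (sub_le_self _ hp0),
    ← map_not_bern, ← Measure.infinitePi_map_pi _ (fun _ => measurable_of_finite _)]
  conv_rhs => rw [← hre, Measure.map_map hnot (by fun_prop)]
  rfl

/-- Resampling one edge leaves the law invariant. -/
lemma mu_resample {p : ℝ} (hp0 : 0 ≤ p) (hp1 : p ≤ 1) (e : Edge) :
    mu p = ENNReal.ofReal p • (mu p).map (fun ω => Function.update ω e true) +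
      ENNReal.ofReal (1 - p) • (mu p).map (fun ω => Function.update ω e false) := by
  have := isProbabilityMeasure_bern hp0 hp1
  conv_lhs => rw [mu_eq_infinitePi hp0 hp1]
  symm
  refine Measure.eq_infinitePi _ fun s t ht => ?_
  have hm (b : Bool) : Measurable fun ω : Config => Function.update ω e b := by fun_prop
  have hpi : MeasurableSet (Set.pi (s : Set Edge) t) := .pi s.countable_toSet fun i _ => ht i
  have key (b : Bool) : (mu p).map (fun ω => Function.update ω e b) (Set.pi s t) =
      (if e ∈ s then (t e).indicator 1 b else 1) * ∏ i ∈ s.erase e, bern p (t i) := by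
    rw [Measure.map_apply (hm b) hpi, mu_eq_infinitePi hp0 hp1]
    by_cases hb : e ∈ s → b ∈ t e
    · have : (fun ω : Config => Function.update ω e b) ⁻¹' Set.pi s t =
          Set.pi (s.erase e : Finset Edge) t := by
        ext ω
        simp only [Set.mem_preimage, Set.mem_pi, Finset.mem_coe, Finset.mem_erase]
        constructor
        · rintro h i ⟨hi, his⟩
          simpa [hi] using h i his
        · intro h i his
          by_cases hi : i = e
          · subst hi; simpa using hb his
          · simpa [hi] using h i ⟨hi, his⟩
      rw [this, Measure.infinitePi_pi _ fun i _ => ht i]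
      split_ifs with hs <;> simp [hb, hs]
    · push Not at hb
      have : (fun ω : Config => Function.update ω e b) ⁻¹' Set.pi s t = ∅ := by
        ext ω
        simp only [Set.mem_preimage, Set.mem_pi, Finset.mem_coe, Set.mem_empty_iff_false, iff_false]
        intro h
        exact hb.2 (by simpa using h e hb.1)
      rw [this]
      simp [hb]
  rw [Measure.add_apply, Measure.smul_apply, Measure.smul_apply, key, key, smul_eq_mul,
    smul_eq_mul, ← mul_assoc, ← mul_assoc, ← add_mul]
  by_cases hs : e ∈ s
  · simp only [if_pos hs]
    rw [← bern_apply, Finset.mul_prod_erase s (fun i => bern p (t i)) hs]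
  · simp only [if_neg hs]
    rw [Finset.erase_eq_of_notMem hs, mul_one, mul_one,
      ← ENNReal.ofReal_add hp0 (sub_nonneg.2 hp1)]
    simp

/-- The configuration `ω` with the bits on `S` replaced by those of `σ`. -/
def override (S : Finset Edge) (σ ω : Config) : Config := fun e => if e ∈ S then σ e else ω e

lemma measurable_override (S : Finset Edge) (σ : Config) : Measurable (override S σ) := by
  refine measurable_pi_iff.2 fun e => ?_
  by_cases h : e ∈ S <;> simp only [override, h, if_true, if_false] <;> fun_prop

/-- Finite energy: forcing the bits on `S` costs at most a factor `min p (1 - p)` per edge. -/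
lemma pow_mul_mu_preimage_override_le {p : ℝ} (hp0 : 0 ≤ p) (hp1 : p ≤ 1) (S : Finset Edge)
    (σ : Config) {B : Set Config} (hB : MeasurableSet B) :
    ENNReal.ofReal (min p (1 - p)) ^ S.card * mu p (override S σ ⁻¹' B) ≤ mu p B := by
  induction S using Finset.induction_on generalizing B with
  | empty => simp [show override ∅ σ = id from funext fun ω => funext fun e => by simp [override]]
  | insert e S he ih =>
    have hm (b : Bool) : Measurable fun ω : Config => Function.update ω e b := by fun_prop
    have hcomp : override (insert e S) σ ⁻¹' B =
        override S σ ⁻¹' ((fun ω => Function.update ω e (σ e)) ⁻¹' B) := by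
      ext ω
      simp only [Set.mem_preimage]
      suffices h : override (insert e S) σ ω = Function.update (override S σ ω) e (σ e) by rw [h]
      ext i
      by_cases hi : i = e
      · subst hi; simp [override]
      · simp [override, hi]
    rw [Finset.card_insert_of_notMem he, pow_succ', mul_assoc, hcomp]
    calc _ ≤ ENNReal.ofReal (min p (1 - p)) *
          mu p ((fun ω => Function.update ω e (σ e)) ⁻¹' B) := by
          gcongr
          exact ih (hm _ hB)
      _ ≤ mu p B := by
          conv_rhs => rw [mu_resample hp0 hp1 e]
          rw [Measure.add_apply, Measure.smul_apply, Measure.smul_apply, smul_eq_mul, smul_eq_mul,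
            Measure.map_apply (hm _) hB, Measure.map_apply (hm _) hB]
          cases σ e
          · refine le_add_left ?_
            gcongr
            exact min_le_right _ _
          · refine le_add_right ?_
            gcongr
            exact min_le_left _ _

lemma gStep_iff (ω : Config) (u v : ℤ × ℤ) :
    gStep ω u v ↔ (v = (u.1 + 1, u.2) ∧ ω (u, false) = true) ∨
      (v = (u.1, u.2 + 1) ∧ ω (u, true) = true) ∨
      (u = (v.1 + 1, v.2) ∧ ω (v, false) = false) ∨
      (u = (v.1, v.2 + 1) ∧ ω (v, true) = false) := by
  constructor
  · rintro ⟨⟨w, b⟩, ⟨rfl, rfl, h⟩ | ⟨rfl, rfl, h⟩⟩ <;> cases b <;> simp_all [eSrc, eDst]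
  · rintro (⟨rfl, h⟩ | ⟨rfl, h⟩ | ⟨rfl, h⟩ | ⟨rfl, h⟩)
    · exact ⟨(u, false), .inl ⟨rfl, rfl, h⟩⟩
    · exact ⟨(u, true), .inl ⟨rfl, rfl, h⟩⟩
    · exact ⟨(v, false), .inr ⟨rfl, rfl, h⟩⟩
    · exact ⟨(v, true), .inr ⟨rfl, rfl, h⟩⟩

/-- `v` can be reached from the origin by a finite directed path inside `S`. -/
def Reach (S : Set (ℤ × ℤ)) (ω : Config) (v : ℤ × ℤ) : Prop :=
  Relation.ReflTransGen (fun u w => gStep ω u w ∧ w ∈ S) (0, 0) v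

/-- Some vertex `v` with `Q v` can be reached from the origin inside `S`. -/
def ReachSet (S : Set (ℤ × ℤ)) (Q : ℤ × ℤ → Prop) : Set Config := {ω | ∃ v, Q v ∧ Reach S ω v}

open Filter Topology in
lemma eventually_gStep {ω : Config} {u v : ℤ × ℤ} (h : gStep ω u v) :
    ∀ᶠ ω' in 𝓝 ω, gStep ω' u v := by
  obtain ⟨e, he⟩ := h
  have : ∀ᶠ ω' in 𝓝 ω, ω' e = ω e :=
    (continuous_apply e).continuousAt.eventually (show ∀ᶠ b in 𝓝 (ω e), b = ω e by simp)
  filter_upwards [this] with ω' h'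
  exact ⟨e, by rwa [h']⟩

open Filter Topology in
lemma measurableSet_reachSet (S : Set (ℤ × ℤ)) (Q : ℤ × ℤ → Prop) :
    MeasurableSet (ReachSet S Q) := by
  have hopen (v : ℤ × ℤ) : IsOpen {ω | Reach S ω v} := by
    refine isOpen_iff_mem_nhds.2 fun ω hω => ?_
    change ∀ᶠ ω' in 𝓝 ω, Reach S ω' v
    have hω : Reach S ω v := hω
    induction hω with
    | refl => exact .of_forall fun _ => .refl
    | tail _ h ih =>
      filter_upwards [ih ‹_›, eventually_gStep h.1] with ω' h1 h2
      exact h1.tail ⟨h2, h.2⟩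
  have : ReachSet S Q = ⋃ v, ⋃ (_ : Q v), {ω | Reach S ω v} := by
    ext ω
    simp [ReachSet]
  rw [this]
  exact (isOpen_iUnion fun v => isOpen_iUnion fun _ => hopen v).measurableSet

lemma reachSet_mono {S : Set (ℤ × ℤ)} {P Q : ℤ × ℤ → Prop} (hPQ : ∀ v, P v → Q v) :
    ReachSet S P ⊆ ReachSet S Q :=
  fun _ ⟨v, hv, h⟩ => ⟨v, hPQ v hv, h⟩

lemma gStep_override {T : Finset Edge} {σ ω : Config} {u v : ℤ × ℤ} (h : gStep ω u v)
    (hT : ∀ e ∈ T, ¬((eSrc e = u ∧ eDst e = v) ∨ (eSrc e = v ∧ eDst e = u))) :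
    gStep (override T σ ω) u v := by
  obtain ⟨e, he⟩ := h
  have heT : e ∉ T := fun h => hT e h (by tauto)
  exact ⟨e, by rwa [show override T σ ω e = ω e from if_neg heT]⟩

lemma eSrc_le_eDst (e : Edge) : eSrc e ≤ eDst e := by
  obtain ⟨v, b⟩ := e
  cases b <;> simp [eSrc, eDst, Prod.le_def]

/-- Changing edges beyond the level `m` of a monotone function does not affect whether this level
is reached. -/
lemma override_mem_reachSet {S : Set (ℤ × ℤ)} {f : ℤ × ℤ → ℤ} (hf : Monotone f) {m : ℤ}
    {T : Finset Edge} {σ ω : Config} (hT : ∀ e ∈ T, m ≤ f (eSrc e))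
    (hω : ω ∈ ReachSet S fun v => m ≤ f v) :
    override T σ ω ∈ ReachSet S fun v => m ≤ f v := by
  by_contra hcon
  have hlt (v) (hv : Reach S (override T σ ω) v) : f v < m :=
    lt_of_not_ge fun h => hcon ⟨v, h, hv⟩
  obtain ⟨v, hmv, hv⟩ := hω
  suffices h : Reach S (override T σ ω) v from absurd (hlt v h) (not_lt.2 hmv)
  clear hmv
  induction hv with
  | refl => exact .refl
  | @tail u w _ h ih =>
    refine ih.tail ⟨gStep_override h.1 fun e he hcase => ?_, h.2⟩
    have h1 : f (eSrc e) ≤ f u := by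
      rcases hcase with ⟨h, -⟩ | ⟨-, h⟩
      · rw [h]
      · rw [← h]; exact hf (eSrc_le_eDst e)
    exact absurd (hT e he) (not_le.2 (h1.trans_lt (hlt u ih)))

open Filter Topology in
/-- If the sets `F k` have probability at most a constant times that of the increments of a
decreasing sequence, then their probabilities tend to zero. -/
lemma tendsto_measure_zero_of_mul_le_diff {α : Type*} [MeasurableSpace α] {μ : Measure α}
    [IsFiniteMeasure μ] {A F : ℕ → Set α} (hA : ∀ k, MeasurableSet (A k)) (hanti : Antitone A)
    {c : ℝ≥0∞} (hc : c ≠ 0) (hc' : c ≠ ∞) {n : ℕ}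
    (h : ∀ k, c * μ (F k) ≤ μ (A k \ A (k + n))) :
    Tendsto (fun k => μ (F k)) atTop (𝓝 0) := by
  have hlim := tendsto_measure_iInter_atTop (μ := μ) (fun k => (hA k).nullMeasurableSet) hanti
    ⟨0, measure_ne_top _ _⟩
  have hdiff : Tendsto (fun k => μ (A k) - μ (A (k + n))) atTop (𝓝 0) := by
    have := ENNReal.Tendsto.sub hlim (hlim.comp (tendsto_add_atTop_nat n))
      (.inl (measure_ne_top _ _))
    simpa using this
  have hmul : Tendsto (fun k => c⁻¹ * (μ (A k) - μ (A (k + n)))) atTop (𝓝 0) := by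
    simpa using ENNReal.Tendsto.const_mul hdiff (.inr (ENNReal.inv_ne_top.2 hc))
  refine tendsto_of_tendsto_of_tendsto_of_le_of_le tendsto_const_nhds hmul (fun _ => zero_le)
    fun k => ?_
  have hk := h k
  rw [measure_sdiff (hanti (Nat.le_add_right k n)) (hA _).nullMeasurableSet
    (measure_ne_top _ _)] at hk
  calc μ (F k) = c⁻¹ * (c * μ (F k)) := by
        rw [← mul_assoc, ENNReal.inv_mul_cancel hc hc', one_mul]
    _ ≤ _ := by gcongr

/-- The vertical strip `[0, k) × [0, ∞)`. -/
def strip (k : ℕ) : Set (ℤ × ℤ) := {v | 0 ≤ v.1 ∧ v.1 < k ∧ 0 ≤ v.2}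

/-- The vertical edges leading from height `m` to height `m + 1` inside the strip. -/
noncomputable def stripEdges (k m : ℕ) : Finset Edge := (Finset.Ico (0 : ℤ) k ×ˢ {(m : ℤ)}) ×ˢ {true}

lemma override_stripEdges_notMem (k m : ℕ) (ω : Config) :
    override (stripEdges k m) (fun _ => false) ω ∉
      ReachSet (strip k) fun v => ((m + 1 : ℕ) : ℤ) ≤ v.2 := by
  rintro ⟨v, hmv, hv⟩
  suffices h : v.2 ≤ m ∧ ((0 ≤ v.1 ∧ v.1 < k) ∨ v = (0, 0)) by
    push_cast at hmv
    omega
  clear hmv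
  induction hv with
  | refl => simp
  | @tail u w _ h ih =>
    obtain ⟨hstep, hw1, hw2, hw3⟩ := h
    refine ⟨?_, .inl ⟨hw1, hw2⟩⟩
    rcases (gStep_iff _ _ _).1 hstep with ⟨rfl, -⟩ | ⟨rfl, hb⟩ | ⟨rfl, -⟩ | ⟨rfl, -⟩
    · exact ih.1
    · by_contra hcon
      have hmem : (u, true) ∈ stripEdges k m := by
        simp only [stripEdges, Finset.mem_product, Finset.mem_Ico, Finset.mem_singleton, and_true]
        simp only at hw1 hw2 hcon
        omega
      simp [override, hmem] at hb
    · exact ih.1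
    · have := ih.1
      simp only at this
      omega

open Filter Topology in
lemma mu_iInter_reachSet_strip {q : ℝ} (hq0 : 0 < q) (hq1 : q < 1) (k : ℕ) :
    mu q (⋂ m : ℕ, ReachSet (strip k) fun v => (m : ℤ) ≤ v.2) = 0 := by
  have := isProbabilityMeasure_mu hq0.le hq1.le
  set A : ℕ → Set Config := fun m => ReachSet (strip k) fun v => (m : ℤ) ≤ v.2
  have hA (m) : MeasurableSet (A m) := measurableSet_reachSet _ _
  have hanti : Antitone A := fun a b hab =>
    reachSet_mono fun v hv => le_trans (by exact_mod_cast hab) hv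
  have hc : ENNReal.ofReal (min q (1 - q)) ≠ 0 := by simp [hq0, hq1]
  have hlim : Tendsto (fun m => mu q (A m)) atTop (𝓝 0) := by
    refine tendsto_measure_zero_of_mul_le_diff hA hanti (pow_ne_zero k hc)
      (ENNReal.pow_ne_top ENNReal.ofReal_ne_top) (n := 1) fun m => ?_
    have hcard : (stripEdges k m).card = k := by simp [stripEdges]
    refine le_trans ?_ (pow_mul_mu_preimage_override_le hq0.le hq1.le (stripEdges k m)
      (fun _ => false) ((hA m).diff (hA (m + 1))))
    rw [hcard]
    gcongr
    intro ω hω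
    refine ⟨override_mem_reachSet (f := Prod.snd) (fun _ _ h => h.2) (fun e he => ?_) hω,
      override_stripEdges_notMem k m ω⟩
    simp only [stripEdges, Finset.mem_product, Finset.mem_singleton] at he
    exact he.1.2.ge
  exact le_antisymm (ge_of_tendsto' hlim fun m => measure_mono (Set.iInter_subset _ m)) zero_le

lemma reach_of_path {S : Set (ℤ × ℤ)} {ω : Config} {γ : ℕ → ℤ × ℤ} (h0 : γ 0 = (0, 0))
    (hstep : ∀ i, gStep ω (γ i) (γ (i + 1))) (hS : ∀ i, γ i ∈ S) (i : ℕ) : Reach S ω (γ i) := by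
  induction i with
  | zero => rw [h0]; exact .refl
  | succ i ih => exact ih.tail ⟨hstep i, hS _⟩

lemma percolates_subset (k : ℕ) :
    {ω | percolates (gStep ω) NEquad} ⊆ (ReachSet NEquad fun v => (k : ℤ) ≤ v.1) ∪
      ⋂ m : ℕ, ReachSet (strip k) fun v => (m : ℤ) ≤ v.2 := by
  rintro ω ⟨γ, h0, hinj, hstep, hS⟩
  by_cases hk : ∃ i, (k : ℤ) ≤ (γ i).1
  · obtain ⟨i, hi⟩ := hk
    exact .inl ⟨γ i, hi, reach_of_path h0 hstep hS i⟩
  · push Not at hk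
    have hstrip (i) : γ i ∈ strip k := ⟨(hS i).1, hk i, (hS i).2⟩
    refine .inr (Set.mem_iInter.2 fun m => ?_)
    by_contra hcon
    have hm (i) : (γ i).2 < m :=
      lt_of_not_ge fun h => hcon ⟨γ i, h, reach_of_path h0 hstep hstrip i⟩
    refine Set.infinite_range_of_injective hinj (Set.Finite.subset
      ((Finset.Ico (0 : ℤ) k ×ˢ Finset.Ico (0 : ℤ) m).finite_toSet) ?_)
    rintro _ ⟨i, rfl⟩
    simpa using ⟨⟨(hS i).1, hk i⟩, (hS i).2, hm i⟩

lemma thetaNE_le_reachSet {q : ℝ} (hq0 : 0 < q) (hq1 : q < 1) (k : ℕ) :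
    thetaNE q ≤ mu q (ReachSet NEquad fun v => (k : ℤ) ≤ v.1) := by
  refine (measure_mono (percolates_subset k)).trans ((measure_union_le _ _).trans ?_)
  rw [mu_iInter_reachSet_strip hq0 hq1, add_zero]

/-- The region `[0, m + n] × [0, ∞)` without the box `(m, m + n] × [0, n)`. -/
def notched (m n : ℕ) : Set (ℤ × ℤ) :=
  {v | 0 ≤ v.1 ∧ v.1 ≤ m + n ∧ 0 ≤ v.2 ∧ ¬((m : ℤ) < v.1 ∧ v.2 < n)}

/-- The edges leading from the notched region into the removed box. -/
noncomputable def notchEdges (m n : ℕ) : Finset Edge :=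
  ({(m : ℤ)} ×ˢ Finset.Ico (0 : ℤ) n) ×ˢ {false} ∪
    (Finset.Ioc (m : ℤ) (m + n) ×ˢ {(n : ℤ) - 1}) ×ˢ {true}

lemma mem_notchEdges {m n : ℕ} {v : ℤ × ℤ} {b : Bool} :
    (v, b) ∈ notchEdges m n ↔ (b = false ∧ v.1 = m ∧ 0 ≤ v.2 ∧ v.2 < n) ∨
      (b = true ∧ (m : ℤ) < v.1 ∧ v.1 ≤ m + n ∧ v.2 = n - 1) := by
  simp only [notchEdges, Finset.mem_union, Finset.mem_product, Finset.mem_singleton,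
    Finset.mem_Ico, Finset.mem_Ioc]
  tauto

lemma override_notchEdges_notMem {m n : ℕ} (hn : 0 < n) {ω : Config}
    (hω : ω ∉ ReachSet (notched m n) fun v => v.1 = m + n) :
    override (notchEdges m n) (fun e => e.2) ω ∉
      ReachSet NEquad fun v => ((m + n : ℕ) : ℤ) ≤ v.1 := by
  rintro ⟨v, hmv, hv⟩
  suffices h : Reach (notched m n) ω v ∧ v ∈ notched m n ∧ v.1 < m + n by
    push_cast at hmv
    omega
  clear hmv
  induction hv with
  | refl => exact ⟨.refl, by simp only [notched, Set.mem_ofPred_eq]; omega, by simp only; omega⟩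
  | @tail u w _ h ih =>
    obtain ⟨hstep, hw1, hw2⟩ := h
    obtain ⟨hu, ⟨hu1, hu2, hu3, hu4⟩, hu5⟩ := ih
    have hval {x : ℤ × ℤ} {b c : Bool}
        (hx : override (notchEdges m n) (fun e => e.2) ω (x, b) = c) :
        ((x, b) ∈ notchEdges m n ∧ b = c) ∨ ((x, b) ∉ notchEdges m n ∧ ω (x, b) = c) := by
      by_cases hmem : (x, b) ∈ notchEdges m n
      · exact .inl ⟨hmem, by simpa [override, hmem] using hx⟩
      · exact .inr ⟨hmem, by simpa [override, hmem] using hx⟩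
    have key : w ∈ notched m n ∧ gStep ω u w := by
      rw [gStep_iff] at hstep ⊢
      obtain ⟨u1, u2⟩ := u
      obtain ⟨w1, w2⟩ := w
      simp only [notched, Set.mem_ofPred_eq, Prod.mk.injEq] at *
      rcases hstep with ⟨hw, hb⟩ | ⟨hw, hb⟩ | ⟨hw, hb⟩ | ⟨hw, hb⟩ <;>
        rcases hval hb with ⟨hmem, hb'⟩ | ⟨hmem, hb'⟩ <;>
        simp only [mem_notchEdges, reduceCtorEq, true_and, false_and, false_or, or_false]
          at hmem hb'
      · exact ⟨by omega, .inl ⟨hw, hb'⟩⟩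
      · omega
      · exact ⟨by omega, .inr (.inl ⟨hw, hb'⟩)⟩
      · omega
      · exact ⟨by omega, .inr (.inr (.inl ⟨hw, hb'⟩))⟩
      · exact ⟨by omega, .inr (.inr (.inr ⟨hw, hb'⟩))⟩
    have hreach : Reach (notched m n) ω w := hu.tail ⟨key.2, key.1⟩
    exact ⟨hreach, key.1, lt_of_le_of_ne key.1.2.1 fun h => hω ⟨w, h, hreach⟩⟩

open Filter Topology in
lemma eventually_half_theta_lt_of_pos_of_lt_one {q : ℝ} (hq0 : 0 < q) (hq1 : q < 1) {n : ℕ} (hn : 0 < n)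
    (hθ : 0 < thetaNE q) :
    ∀ᶠ m : ℕ in atTop, thetaNE q / 2 < mu q (ReachSet (notched m n) fun v => v.1 = m + n) := by
  have := isProbabilityMeasure_mu hq0.le hq1.le
  set A : ℕ → Set Config := fun m => ReachSet NEquad fun v => (m : ℤ) ≤ v.1
  have hA (m) : MeasurableSet (A m) := measurableSet_reachSet _ _
  have hanti : Antitone A := fun a b hab =>
    reachSet_mono fun v hv => le_trans (by exact_mod_cast hab) hv
  have hc : ENNReal.ofReal (min q (1 - q)) ≠ 0 := by simp [hq0, hq1]
  have hlim : Tendsto (fun m => mu q (A (m + n) \ ReachSet (notched m n) fun v => v.1 = m + n))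
      atTop (𝓝 0) := by
    refine tendsto_measure_zero_of_mul_le_diff hA hanti (pow_ne_zero (n + n) hc)
      (ENNReal.pow_ne_top ENNReal.ofReal_ne_top) (n := n) fun m => ?_
    have hcard : (notchEdges m n).card = n + n := by
      rw [notchEdges, Finset.card_union_of_disjoint]
      · simp
      · exact Finset.disjoint_left.2 fun e h1 h2 => by
          simp only [Finset.mem_product, Finset.mem_singleton] at h1 h2
          simp [h1.2] at h2
    refine le_trans ?_ (pow_mul_mu_preimage_override_le hq0.le hq1.le (notchEdges m n)
      (fun e => e.2) ((hA m).diff (hA (m + n))))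
    rw [hcard]
    gcongr
    rintro ω ⟨hω, hω'⟩
    refine ⟨override_mem_reachSet (f := Prod.fst) (fun _ _ h => h.1) (fun ⟨e, b⟩ he => ?_)
      (hanti (Nat.le_add_right m n) hω), override_notchEdges_notMem hn hω'⟩
    rw [mem_notchEdges] at he
    simp only [eSrc]
    omega
  have hθtop : thetaNE q ≠ ∞ := measure_ne_top _ _
  filter_upwards [hlim.eventually_lt_const (ENNReal.half_pos hθ.ne')] with m hm
  have hle : thetaNE q ≤ mu q (ReachSet (notched m n) fun v => v.1 = m + n) +
      mu q (A (m + n) \ ReachSet (notched m n) fun v => v.1 = m + n) :=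
    (thetaNE_le_reachSet hq0 hq1 (m + n)).trans
      ((measure_mono (by rw [Set.union_sdiff_self]; exact Set.subset_union_right)).trans
        (measure_union_le _ _))
  rw [← ENNReal.add_halves (thetaNE q)] at hle
  by_contra hcon
  refine absurd hle (not_le.2 ?_)
  exact ENNReal.add_lt_add_of_le_of_lt (ne_top_of_le_ne_top (by finiteness) (not_lt.1 hcon))
    (not_lt.1 hcon) hm

lemma mu_zero : mu 0 = Measure.dirac fun _ => false := by
  have : bern 0 = Measure.dirac false := by simp [bern]
  rw [mu_eq_infinitePi le_rfl zero_le_one, this, Measure.infinitePi_dirac]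

lemma mu_one : mu 1 = Measure.dirac fun _ => true := by
  have : bern 1 = Measure.dirac true := by simp [bern]
  rw [mu_eq_infinitePi zero_le_one le_rfl, this, Measure.infinitePi_dirac]

lemma thetaNE_zero : thetaNE 0 = 0 := by
  rw [thetaNE, mu_zero, Measure.dirac_apply]
  refine Set.indicator_of_notMem ?_ _
  rintro ⟨γ, h0, -, hstep, hS⟩
  have h1 := hS 1
  simp only [NEquad, Set.mem_ofPred_eq] at h1
  have h := (gStep_iff _ _ _).1 (hstep 0)
  rw [h0] at h
  simp only [reduceCtorEq, and_false, Prod.mk.injEq, and_true, false_or, zero_add] at h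
  omega

lemma const_true_mem_reachSet (m n : ℕ) :
    (fun _ => true) ∈ ReachSet (notched m n) fun v => v.1 = m + n := by
  have hup (j : ℕ) : Reach (notched m n) (fun _ => true) (0, (j : ℤ)) := by
    induction j with
    | zero => exact .refl
    | succ j ih =>
      refine ih.tail ⟨(gStep_iff _ _ _).2 (.inr (.inl ⟨by simp, rfl⟩)), ?_⟩
      simp only [notched, Set.mem_ofPred_eq]
      omega
  have hright (i : ℕ) (hi : i ≤ m + n) :
      Reach (notched m n) (fun _ => true) ((i : ℤ), (n : ℤ)) := by
    induction i with
    | zero => exact hup n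
    | succ i ih =>
      refine (ih (by omega)).tail ⟨(gStep_iff _ _ _).2 (.inl ⟨by simp, rfl⟩), ?_⟩
      simp only [notched, Set.mem_ofPred_eq]
      omega
  exact ⟨((m + n : ℕ), n), by simp, hright _ le_rfl⟩

open Filter Topology in
lemma eventually_half_theta_lt {q : ℝ} (hq0 : 0 ≤ q) (hq1 : q ≤ 1) {n : ℕ} (hn : 0 < n)
    (hθ : 0 < thetaNE q) :
    ∀ᶠ m : ℕ in atTop, thetaNE q / 2 < mu q (ReachSet (notched m n) fun v => v.1 = m + n) := by
  have := isProbabilityMeasure_mu hq0 hq1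
  rcases hq0.eq_or_lt with rfl | hq0
  · simp [thetaNE_zero] at hθ
  rcases hq1.eq_or_lt with rfl | hq1
  · refine .of_forall fun m => ?_
    have hone : mu 1 (ReachSet (notched m n) fun v => v.1 = m + n) = 1 := by
      rw [mu_one, Measure.dirac_apply]
      exact Set.indicator_of_mem (const_true_mem_reachSet m n) _
    rw [hone]
    calc thetaNE 1 / 2 ≤ 1 / 2 := by
          gcongr
          exact prob_le_one
      _ < 1 := ENNReal.half_lt_self one_ne_zero ENNReal.one_ne_top
  · exact eventually_half_theta_lt_of_pos_of_lt_one hq0 hq1 hn hθ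

/-- The primal edge of the H-model crossed by the dual edge which, after the reflection
`(x, y) ↦ (k - x, y)`, is the edge `e`. -/
def crossing (k : ℤ) (e : Edge) : Edge :=
  if e.2 then ((k - e.1.1, e.1.2 + 1), false) else ((k - e.1.1, e.1.2), true)

lemma crossing_injective (k : ℤ) : Function.Injective (crossing k) := by
  rintro ⟨⟨x, y⟩, b⟩ ⟨⟨x', y'⟩, b'⟩ h
  cases b <;> cases b' <;> simp_all [crossing]

lemma hPos_iff_of_nonneg {ω : Config} {a b : ℤ} (ha : 0 ≤ a) (hb : 0 ≤ b) (c : Bool) :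
    hPos ω ((a, b), c) ↔ ω ((a, b), c) = true := by
  have : normSq (eSrc ((a, b), c)) < normSq (eDst ((a, b), c)) := by
    cases c <;> simp [normSq, eSrc, eDst] <;> nlinarith
  simp [hPos, this]

lemma dualStep_of_gStep {ω : Config} {k : ℤ} {u v : ℤ × ℤ}
    (h : gStep (fun e => !ω (crossing k e)) u v) (hu1 : u.1 ≤ k) (hu2 : 0 ≤ u.2)
    (hv1 : v.1 ≤ k) (hv2 : 0 ≤ v.2) : dualStep ω (k - u.1, u.2) (k - v.1, v.2) := by
  rcases (gStep_iff _ _ _).1 h with ⟨rfl, hb⟩ | ⟨rfl, hb⟩ | ⟨rfl, hb⟩ | ⟨rfl, hb⟩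
  · refine .inr (.inl ⟨by ext <;> simp; ring, ?_⟩)
    rw [hPos_iff_of_nonneg (by simp only; omega) hu2]
    simpa [crossing, sub_add_eq_sub_sub] using hb
  · refine .inr (.inr (.inl ⟨rfl, ?_⟩))
    rw [hPos_iff_of_nonneg (by simp only; omega) hv2]
    simpa [crossing] using hb
  · refine .inl ⟨by ext <;> simp; ring, ?_⟩
    rw [hPos_iff_of_nonneg (by simp only; omega) hv2]
    simpa [crossing, sub_add_eq_sub_sub] using hb
  · refine .inr (.inr (.inr ⟨rfl, ?_⟩))
    rw [hPos_iff_of_nonneg (by simp only; omega) hu2]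
    simpa [crossing] using hb

lemma inBox_mono {m m' : ℕ} (h : m ≤ m') {v : ℤ × ℤ} (hv : inBox m v) : inBox m' v := by
  simp only [inBox] at hv ⊢
  omega

lemma exists_dual_path {m n : ℕ} {ω : Config} {v : ℤ × ℤ}
    (hv : Reach (notched m n) (fun e => !ω (crossing (m + n) e)) v) :
    v ∈ notched m n ∧ ∃ (γ : ℕ → ℤ × ℤ) (L M : ℕ), γ 0 = (((m + n : ℕ) : ℤ), 0) ∧
      γ L = (m + n - v.1, v.2) ∧ (∀ i < L, dualStep ω (γ i) (γ (i + 1))) ∧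
      ∀ i ≤ L, dualNE (γ i) ∧ inBox M (γ i) ∧ ¬inBox n (γ i) := by
  have hpt {v : ℤ × ℤ} (hv : v ∈ notched m n) : dualNE ((m : ℤ) + n - v.1, v.2) ∧
      ¬inBox n ((m : ℤ) + n - v.1, v.2) ∧
      inBox (m + n + 1 + v.2.toNat) ((m : ℤ) + n - v.1, v.2) := by
    simp only [notched, Set.mem_ofPred_eq] at hv
    simp only [dualNE, inBox]
    omega
  induction hv with
  | refl =>
    have h0 : ((0, 0) : ℤ × ℤ) ∈ notched m n := by
      simp only [notched, Set.mem_ofPred_eq]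
      omega
    have h := hpt h0
    simp only [sub_zero] at h
    refine ⟨h0, fun _ => ((m : ℤ) + n, 0), 0, _, by simp, by simp, by simp,
      fun i _ => ⟨h.1, h.2.2, h.2.1⟩⟩
  | @tail u w _ h ih =>
    obtain ⟨hu, γ, L, M, h0, hL, hstep, hall⟩ := ih
    have hw := hpt h.2
    refine ⟨h.2, fun i => if i ≤ L then γ i else (m + n - w.1, w.2), L + 1,
      max M (m + n + 1 + w.2.toNat), by simpa using h0, by simp, fun i hi => ?_, fun i _ => ?_⟩
    · rcases (Nat.lt_succ_iff.1 hi).eq_or_lt with rfl | hi'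
      · simp only [le_refl, if_true, show ¬i + 1 ≤ i by omega, if_false, hL]
        exact dualStep_of_gStep h.1 hu.2.1 hu.2.2.1 h.2.2.1 h.2.2.2.1
      · simp only [hi'.le, if_true, show i + 1 ≤ L by omega]
        exact hstep i hi'
    · by_cases hi : i ≤ L
      · simp only [hi, if_true]
        obtain ⟨h1, h2, h3⟩ := hall i hi
        exact ⟨h1, inBox_mono (le_max_left _ _) h2, h3⟩
      · simp only [hi, if_false]
        exact ⟨hw.1, inBox_mono (le_max_right _ _) hw.2.2, hw.2.1⟩

lemma bplusIn_mono {M M' n k : ℕ} (h : M ≤ M') {ω : Config} (hω : BplusIn M n k ω) :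
    BplusIn M' n k ω := by
  obtain ⟨γ, L, h0, hL, hstep, hall⟩ := hω
  exact ⟨γ, L, h0, hL, hstep, fun i hi =>
    ⟨(hall i hi).1, inBox_mono h (hall i hi).2.1, (hall i hi).2.2⟩⟩

lemma mu_reachSet_notched_le {p : ℝ} (hp0 : 0 ≤ p) (hp1 : p ≤ 1) (m n : ℕ) :
    mu (1 - p) (ReachSet (notched m n) fun v => v.1 = m + n) ≤
      mu p (⋃ M, {ω | BplusIn M n (m + n) ω}) := by
  have hmeas : Measurable fun (ω : Config) e => !ω (crossing (m + n) e) :=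
    measurable_pi_iff.2 fun e => (measurable_of_finite not).comp (measurable_pi_apply _)
  rw [← map_not_reindex_mu hp0 hp1 (crossing_injective (m + n)),
    Measure.map_apply hmeas (measurableSet_reachSet _ _)]
  refine measure_mono ?_
  rintro ω ⟨v, hv, hreach⟩
  obtain ⟨-, γ, L, M, h0, hL, hstep, hall⟩ := exists_dual_path hreach
  exact Set.mem_iUnion.2 ⟨M, γ, L, h0, by rw [hL, hv]; simp, hstep, hall⟩

/-- If `θ = θ_NE(1-p) > 0`, then for any `n, d > 0` there exist
`0 < N < M₀ < M` with `M₀ - N > d` such that `P(B⁺_{M,n}(x)) > θ/2` for every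
`x ∈ [N, M₀]`. -/
theorem exists_BplusIn_gt_half_theta (p : ℝ) (hp0 : 0 ≤ p) (hp1 : p ≤ 1)
    (hθ : 0 < thetaNE (1 - p)) (n d : ℕ) (hn : 0 < n) (hd : 0 < d) :
    ∃ N M₀ M : ℕ, 0 < N ∧ N < M₀ ∧ M₀ < M ∧ N + d < M₀ ∧
      ∀ k : ℕ, N ≤ k → k ≤ M₀ →
        thetaNE (1 - p) / 2 < mu p {ω | BplusIn M n k ω} := by
  have hev := eventually_half_theta_lt (sub_nonneg.2 hp1) (sub_le_self _ hp0) hn hθ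
  obtain ⟨m₀, hm₀⟩ := Filter.eventually_atTop.1 hev
  have hM (k : ℕ) (hk : m₀ + n ≤ k) :
      ∃ M, thetaNE (1 - p) / 2 < mu p {ω | BplusIn M n k ω} := by
    obtain ⟨m, rfl⟩ : ∃ m, k = m + n := ⟨k - n, by omega⟩
    have h := (hm₀ m (by omega)).trans_le (mu_reachSet_notched_le hp0 hp1 m n)
    have hmono : Monotone fun M => {ω | BplusIn M n (m + n) ω} :=
      fun _ _ hM _ hω => bplusIn_mono hM hω
    rwa [hmono.measure_iUnion, lt_iSup_iff] at h
  choose! M hM using hM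
  set M₀ := m₀ + n + d + 1
  refine ⟨m₀ + n, M₀, M₀ + 1 + (Finset.range (M₀ + 1)).sup M, by omega, by omega, by omega,
    by omega, fun k hk hk' => (hM k hk).trans_le (measure_mono fun ω hω => bplusIn_mono ?_ hω)⟩
  have := Finset.le_sup (f := M) (Finset.mem_range.2 (show k < M₀ + 1 by omega))
  omega

end RandomOrientation
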